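/- Let α ∈ ℝ. On ℝ⁶ with coordinates (t,x,y,u,v,h), the four vector fields D(1), D(t), D(t²), and K = α·Dˢ + 4J, where Dˢ = x∂_x + y∂_y + u∂_u + v∂_v + 2h∂_h and J = x∂_y − y∂_x + u∂_v − v∂_u, are linearly independent, their span is closed under the Lie bracket of vector fields with [D(1), D(t)] = D(1), [D(1), D(t²)] = 2D(t), [D(t), D(t²)] = D(t²), and [K, D(1)] = [K, D(t)] = [K, D(t²)] = 0, and this four-dimensional Lie algebra is isomorphic to the direct sum sl(2,ℝ) ⊕ ℝ of sl(2,ℝ) and the one-dimensional abelian Lie algebra. (This is the maximal Lie invariance algebra in the case b = ε r^{−2} e^{αφ}.) -/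

import Mathlib

noncomputable section

open Real Set

/-- The Lie bracket of vector fields on ℝ⁶ (identified with smooth maps),
`[X,Y](p) = DY(p)·X(p) − DX(p)·Y(p)`. -/
def lieVF (X Y : (Fin 6 → ℝ) → (Fin 6 → ℝ)) : (Fin 6 → ℝ) → (Fin 6 → ℝ) :=
  fun p => fderiv ℝ Y p (X p) - fderiv ℝ X p (Y p)

/-- `D(1) = ∂_t` on ℝ⁶ with coordinates `(t,x,y,u,v,h)`. -/
def D1 : (Fin 6 → ℝ) → (Fin 6 → ℝ) := fun _ => ![1, 0, 0, 0, 0, 0]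

/-- `D(t) = t∂_t + ½x∂_x + ½y∂_y − ½u∂_u − ½v∂_v − h∂_h`. -/
def Dt : (Fin 6 → ℝ) → (Fin 6 → ℝ) := fun p =>
  ![p 0, p 1 / 2, p 2 / 2, -(p 3) / 2, -(p 4) / 2, -(p 5)]

/-- `D(t²) = t²∂_t + tx∂_x + ty∂_y + (x − tu)∂_u + (y − tv)∂_v − 2th∂_h`. -/
def Dt2 : (Fin 6 → ℝ) → (Fin 6 → ℝ) := fun p =>
  ![(p 0) ^ 2, p 0 * p 1, p 0 * p 2, p 1 - p 0 * p 3, p 2 - p 0 * p 4, -(2 * p 0 * p 5)]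

/-- `K = α·Dˢ + 4J`, where `Dˢ = x∂_x + y∂_y + u∂_u + v∂_v + 2h∂_h` and
`J = x∂_y − y∂_x + u∂_v − v∂_u`. -/
def VK (α : ℝ) : (Fin 6 → ℝ) → (Fin 6 → ℝ) := fun p =>
  ![0, α * p 1 - 4 * p 2, α * p 2 + 4 * p 1, α * p 3 - 4 * p 4, α * p 4 + 4 * p 3,
    2 * α * p 5]

theorem differentiable_D1 : Differentiable ℝ D1 := by
  unfold D1
  fun_prop

theorem differentiable_Dt : Differentiable ℝ Dt := by
  refine differentiable_pi.2 fun i => ?_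
  fin_cases i <;> simp [Dt] <;> fun_prop

theorem differentiable_Dt2 : Differentiable ℝ Dt2 := by
  refine differentiable_pi.2 fun i => ?_
  fin_cases i <;> simp [Dt2] <;> fun_prop

theorem differentiable_VK (α : ℝ) : Differentiable ℝ (VK α) := by
  refine differentiable_pi.2 fun i => ?_
  fin_cases i <;> simp [VK] <;> fun_prop

theorem fderiv_D1_apply (p v : Fin 6 → ℝ) : fderiv ℝ D1 p v = 0 := by
  unfold D1
  simp

theorem fderiv_Dt_apply (p v : Fin 6 → ℝ) : fderiv ℝ Dt p v = Dt v := by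
  let L : (Fin 6 → ℝ) →ₗ[ℝ] (Fin 6 → ℝ) :=
    { toFun := Dt
      map_add' := fun a b => by
        ext i; fin_cases i <;> simp [Dt] <;> ring
      map_smul' := fun c a => by
        ext i; fin_cases i <;> simp [Dt] <;> ring }
  exact congrArg (fun T => T v) (L.toContinuousLinearMap.fderiv (x := p))

theorem fderiv_VK_apply (α : ℝ) (p v : Fin 6 → ℝ) : fderiv ℝ (VK α) p v = VK α v := by
  let L : (Fin 6 → ℝ) →ₗ[ℝ] (Fin 6 → ℝ) :=
    { toFun := VK α
      map_add' := fun a b => by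
        ext i; fin_cases i <;> simp [VK] <;> ring
      map_smul' := fun c a => by
        ext i; fin_cases i <;> simp [VK] <;> ring }
  exact congrArg (fun T => T v) (L.toContinuousLinearMap.fderiv (x := p))

theorem fderiv_Dt2_apply (p v : Fin 6 → ℝ) :
    fderiv ℝ Dt2 p v =
      ![2 * p 0 * v 0, v 0 * p 1 + p 0 * v 1, v 0 * p 2 + p 0 * v 2,
        v 1 - (v 0 * p 3 + p 0 * v 3), v 2 - (v 0 * p 4 + p 0 * v 4),
        -(2 * (v 0 * p 5 + p 0 * v 5))] := by
  have c := fun i : Fin 6 => hasFDerivAt_apply (𝕜 := ℝ) i p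
  ext i
  refine (congrArg (fun T => T v) (fderiv_apply (differentiable_Dt2 p) i)).symm.trans ?_
  fin_cases i
  · refine (congrArg (fun T => T v) ((c 0).pow 2).fderiv).trans ?_
    simp
  · refine (congrArg (fun T => T v) ((c 0).mul (c 1)).fderiv).trans ?_
    simp; ring
  · refine (congrArg (fun T => T v) ((c 0).mul (c 2)).fderiv).trans ?_
    simp; ring
  · refine (congrArg (fun T => T v) ((c 1).sub ((c 0).mul (c 3))).fderiv).trans ?_
    simp; ring
  · refine (congrArg (fun T => T v) ((c 2).sub ((c 0).mul (c 4))).fderiv).trans ?_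
    simp; ring
  · refine (congrArg (fun T => T v) (((c 0).const_mul 2).mul (c 5)).neg.fderiv).trans ?_
    simp; ring

theorem lieVF_D1_Dt : lieVF D1 Dt = D1 := by
  ext p i
  simp only [lieVF, fderiv_D1_apply, fderiv_Dt_apply]
  fin_cases i <;> simp [D1, Dt]

theorem lieVF_D1_Dt2 : lieVF D1 Dt2 = (2 : ℝ) • Dt := by
  ext p i
  simp only [lieVF, fderiv_D1_apply, fderiv_Dt2_apply]
  fin_cases i <;> simp [D1, Dt] <;> ring

theorem lieVF_Dt_Dt2 : lieVF Dt Dt2 = Dt2 := by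
  ext p i
  simp only [lieVF, fderiv_Dt_apply, fderiv_Dt2_apply]
  fin_cases i <;> simp [Dt, Dt2] <;> ring

theorem lieVF_VK_D1 (α : ℝ) : lieVF (VK α) D1 = 0 := by
  ext p i
  simp only [lieVF, fderiv_VK_apply, fderiv_D1_apply]
  fin_cases i <;> simp [VK, D1]

theorem lieVF_VK_Dt (α : ℝ) : lieVF (VK α) Dt = 0 := by
  ext p i
  simp only [lieVF, fderiv_VK_apply, fderiv_Dt_apply]
  fin_cases i <;> simp [VK, Dt] <;> ring

theorem lieVF_VK_Dt2 (α : ℝ) : lieVF (VK α) Dt2 = 0 := by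
  ext p i
  simp only [lieVF, fderiv_VK_apply, fderiv_Dt2_apply]
  fin_cases i <;> simp [VK, Dt2] <;> ring

theorem linearIndependent_fields (α : ℝ) : LinearIndependent ℝ ![D1, Dt, Dt2, VK α] := by
  rw [Fintype.linearIndependent_iff]
  intro g hg
  simp only [Fin.sum_univ_four] at hg
  have ev := fun p i => congrFun (congrFun hg p) i
  have h0 := ev 0 0
  have h1 := ev ![1, 0, 0, 0, 0, 0] 0
  have h2 := ev ![-1, 0, 0, 0, 0, 0] 0
  have h3 := ev ![0, 1, 0, 0, 0, 0] 2
  simp [D1, Dt, Dt2, VK] at h0 h1 h2 h3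
  intro i
  fin_cases i <;> simp <;> linarith

/-- The bracket of two linear combinations of the basis fields. -/
theorem lieVF_combination (α a b c d a' b' c' d' : ℝ) :
    lieVF (a • D1 + b • Dt + c • Dt2 + d • VK α) (a' • D1 + b' • Dt + c' • Dt2 + d' • VK α) =
      (a * b' - b * a') • D1 + (2 * (a * c' - c * a')) • Dt + (b * c' - c * b') • Dt2 := by
  have fd : ∀ (a b c d : ℝ) (p v : Fin 6 → ℝ),
      fderiv ℝ (a • D1 + b • Dt + c • Dt2 + d • VK α) p v =
        a • fderiv ℝ D1 p v + b • fderiv ℝ Dt p v + c • fderiv ℝ Dt2 p v +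
          d • fderiv ℝ (VK α) p v := fun a b c d p v =>
    congrArg (fun T => T v)
      (((((differentiable_D1 p).hasFDerivAt.const_smul a).add
        ((differentiable_Dt p).hasFDerivAt.const_smul b)).add
        ((differentiable_Dt2 p).hasFDerivAt.const_smul c)).add
        ((differentiable_VK α p).hasFDerivAt.const_smul d)).fderiv
  ext p i
  simp only [lieVF, fd, fderiv_D1_apply, fderiv_Dt_apply, fderiv_VK_apply, fderiv_Dt2_apply]
  fin_cases i <;> simp [D1, Dt, Dt2, VK] <;> ring

/-- The linear map sending the standard generators `e, h, f` of `sl(2, ℝ)` to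
`D(t²), 2D(t), -D(1)`, and `1` in the second factor to `K`. -/
def slProdToField (α : ℝ) :
    (LieAlgebra.SpecialLinear.sl (Fin 2) ℝ × ℝ) →ₗ[ℝ] ((Fin 6 → ℝ) → (Fin 6 → ℝ)) where
  toFun z := (-z.1.1 1 0) • D1 + (2 * z.1.1 0 0) • Dt + z.1.1 0 1 • Dt2 + z.2 • VK α
  map_add' z w := by
    simp
    module
  map_smul' r z := by
    simp
    module

theorem slProdToField_apply (α : ℝ) (z : LieAlgebra.SpecialLinear.sl (Fin 2) ℝ × ℝ) :
    slProdToField α z =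
      (-z.1.1 1 0) • D1 + (2 * z.1.1 0 0) • Dt + z.1.1 0 1 • Dt2 + z.2 • VK α := rfl

theorem sl_two_apply_one_one (X : LieAlgebra.SpecialLinear.sl (Fin 2) ℝ) :
    X.1 1 1 = -X.1 0 0 := by
  have h : Matrix.trace X.1 = 0 := X.2
  rw [Matrix.trace_fin_two] at h
  linarith

theorem slProdToField_injective (α : ℝ) : Function.Injective (slProdToField α) := by
  refine (injective_iff_map_eq_zero _).2 fun z hz => ?_
  have h := Fintype.linearIndependent_iff.1 (linearIndependent_fields α)
    ![-z.1.1 1 0, 2 * z.1.1 0 0, z.1.1 0 1, z.2] (by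
      rw [Fin.sum_univ_four]
      exact hz)
  have h0 := h 0
  have h1 := h 1
  have h2 := h 2
  have h3 := h 3
  simp at h0 h1 h2 h3
  refine Prod.ext (Subtype.ext ?_) h3
  have h4 := sl_two_apply_one_one z.1
  ext i j
  fin_cases i <;> fin_cases j <;> simp [h0, h1, h2, h4]

theorem range_slProdToField (α : ℝ) :
    LinearMap.range (slProdToField α) = Submodule.span ℝ {D1, Dt, Dt2, VK α} := by
  apply le_antisymm
  · rintro _ ⟨z, rfl⟩
    rw [slProdToField_apply]
    refine add_mem (add_mem (add_mem ?_ ?_) ?_) ?_ <;>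
      exact Submodule.smul_mem _ _ (Submodule.subset_span (by simp))
  · have key : ∀ a b c d : ℝ, a • D1 + b • Dt + c • Dt2 + d • VK α ∈
        LinearMap.range (slProdToField α) := fun a b c d =>
      ⟨(⟨!![b / 2, c; -a, -(b / 2)], by
        change Matrix.trace !![b / 2, c; -a, -(b / 2)] = 0
        simp [Matrix.trace_fin_two]⟩, d), by
        simp [slProdToField_apply, mul_div_cancel₀]⟩
    rw [Submodule.span_le]
    rintro X (rfl | rfl | rfl | rfl)
    · simpa using key 1 0 0 0
    · simpa using key 0 1 0 0
    · simpa using key 0 0 1 0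
    · simpa using key 0 0 0 1

theorem lieVF_slProdToField (α : ℝ) (X Y : LieAlgebra.SpecialLinear.sl (Fin 2) ℝ) (s s' : ℝ) :
    lieVF (slProdToField α (X, s)) (slProdToField α (Y, s')) = slProdToField α (⁅X, Y⁆, 0) := by
  have hX := sl_two_apply_one_one X
  have hY := sl_two_apply_one_one Y
  simp only [slProdToField_apply, lieVF_combination, LieSubalgebra.coe_bracket,
    Ring.lie_def, Matrix.sub_apply, Matrix.mul_apply, Fin.sum_univ_two, hX, hY]
  module

/-- `D(1)`, `D(t)`, `D(t²)`, `K = αDˢ + 4J` are linearly independent, their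
span is closed under the Lie bracket with `[D(1),D(t)] = D(1)`, `[D(1),D(t²)] = 2D(t)`,
`[D(t),D(t²)] = D(t²)` and `K` central, and this four-dimensional Lie algebra is
isomorphic to `sl(2,ℝ) ⊕ ℝ`. -/
theorem stmt_19 (α : ℝ) :
    LinearIndependent ℝ ![D1, Dt, Dt2, VK α] ∧
    lieVF D1 Dt = D1 ∧
    lieVF D1 Dt2 = (2 : ℝ) • Dt ∧
    lieVF Dt Dt2 = Dt2 ∧
    lieVF (VK α) D1 = 0 ∧ lieVF (VK α) Dt = 0 ∧ lieVF (VK α) Dt2 = 0 ∧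
    (∀ X ∈ Submodule.span ℝ {D1, Dt, Dt2, VK α},
      ∀ Y ∈ Submodule.span ℝ {D1, Dt, Dt2, VK α},
        lieVF X Y ∈ Submodule.span ℝ {D1, Dt, Dt2, VK α}) ∧
    ∃ e : (↥(LieAlgebra.SpecialLinear.sl (Fin 2) ℝ) × ℝ) ≃ₗ[ℝ]
        ↥(Submodule.span ℝ {D1, Dt, Dt2, VK α}),
      ∀ (X Y : ↥(LieAlgebra.SpecialLinear.sl (Fin 2) ℝ)) (s s' : ℝ),
        (↑(e (⁅X, Y⁆, 0)) : (Fin 6 → ℝ) → (Fin 6 → ℝ)) = lieVF ↑(e (X, s)) ↑(e (Y, s')) := by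
  refine ⟨linearIndependent_fields α, lieVF_D1_Dt, lieVF_D1_Dt2, lieVF_Dt_Dt2, lieVF_VK_D1 α,
    lieVF_VK_Dt α, lieVF_VK_Dt2 α, ?_, ?_⟩
  · rw [← range_slProdToField]
    rintro _ ⟨⟨X, s⟩, rfl⟩ _ ⟨⟨Y, s'⟩, rfl⟩
    exact ⟨(⁅X, Y⁆, 0), (lieVF_slProdToField α X Y s s').symm⟩
  · exact ⟨(LinearEquiv.ofInjective _ (slProdToField_injective α)).trans
      (LinearEquiv.ofEq _ _ (range_slProdToField α)),
      fun X Y s s' => (lieVF_slProdToField α X Y s s').symm⟩
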